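/- arXiv:1302.0881 — 2 statements merged into one kernel-verified Lean document; each statement's English description precedes it below -/
import Mathlib

section
/- Let k ≥ 1 be an integer and a ≠ 0 a real number with c_k^{−a}(−n) ≠ 0 for all integers n ≥ 1. Let L be the linear functional on ℝ[X] given by L(p) = Σ_{x=0}^{∞} (∏_{j=1}^{k}(x−j)) · (a^x/x!) · p(x), and let (r_n)_{n≥0} be polynomials with deg r_n = n that are orthogonal with respect to L (i.e. L(r_n·X^m) = 0 for 0 ≤ m < n and L(r_n·X^n) ≠ 0). Then there exist polynomials f_{−k−1}, f_{−k}, …, f_{k+1} with f_{−k−1} ≠ 0 and f_{k+1} ≠ 0 and real numbers λ_n, n ≥ 0, such that Σ_{l=−k−1}^{k+1} f_l(x)·r_n(x+l) = λ_n·r_n(x) for every n ≥ 0 and all x; that is, the (r_n)_n are common eigenfunctions of a difference operator of order 2k+2 and genre (−k−1, k+1). -/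
open Polynomial

/-- The Charlier polynomial `c_n^a(x) = (1/n!) ∑_{j=0}^n (-a)^{n-j} C(n,j) x(x-1)⋯(x-j+1)`. -/
noncomputable def charlier (a : ℝ) (n : ℕ) : ℝ[X] :=
  C ((n.factorial : ℝ))⁻¹ * ∑ j ∈ Finset.range (n+1),
    C ((-a)^(n-j) * (n.choose j : ℝ)) * ∏ i ∈ Finset.range j, (X - C (i : ℝ))

/-- The operator `p(x) ↦ A(x) p(x+1) + B(x) p(x) + G(x) p(x-1)`. -/
noncomputable def threeTerm (A B G : ℝ[X]) : Module.End ℝ ℝ[X] :=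
  LinearMap.mulLeft ℝ A ∘ₗ taylor 1 + LinearMap.mulLeft ℝ B +
    LinearMap.mulLeft ℝ G ∘ₗ taylor (-1)

lemma threeTerm_apply (A B G p : ℝ[X]) :
    threeTerm A B G p = A * taylor 1 p + B * p + G * taylor (-1) p := rfl

/-- `T` is a difference operator `∑ f_l(x) p(x+l)` with `|l| ≤ m`, `f_{-m} = u` and `f_m = v`. -/
def HasGenre (T : Module.End ℝ ℝ[X]) (m : ℕ) (u v : ℝ[X]) : Prop :=
  ∃ f : ℤ → ℝ[X], (∀ l : ℤ, (m : ℤ) < |l| → f l = 0) ∧ f (-m) = u ∧ f m = v ∧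
    ∀ p, T p = ∑ l ∈ Finset.Icc (-(m : ℤ)) m, f l * taylor (l : ℝ) p

lemma sum_Icc_shift {M : Type*} [AddCommMonoid M] (m : ℕ) (F : ℤ → M)
    (hF : ∀ l : ℤ, (m : ℤ) < |l| → F l = 0) (j : ℤ) (hj : |j| ≤ 1) :
    ∑ l ∈ Finset.Icc (-((m : ℤ) + 1)) (m + 1), F (l + j) =
      ∑ l ∈ Finset.Icc (-(m : ℤ)) m, F l := by
  have mem {l : ℤ} (h : F l ≠ 0) : -(m : ℤ) ≤ l ∧ l ≤ m :=
    abs_le.mp (not_lt.mp fun h' => h (hF l h'))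
  have hj' := abs_le.mp hj
  rw [← finsum_eq_sum_of_support_subset (fun l => F (l + j)),
    ← finsum_eq_sum_of_support_subset F]
  · exact finsum_comp_equiv (Equiv.addRight j) (f := F)
  · intro l hl
    simpa using mem hl
  · intro l hl
    have := mem hl
    simp only [Finset.coe_Icc, Set.mem_Icc]
    omega

namespace HasGenre

variable {T T' : Module.End ℝ ℝ[X]} {m : ℕ} {u v u' v' : ℝ[X]}

lemma add (h : HasGenre T m u v) (h' : HasGenre T' m u' v') :
    HasGenre (T + T') m (u + u') (v + v') := by
  obtain ⟨f, hf, rfl, rfl, hT⟩ := h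
  obtain ⟨f', hf', rfl, rfl, hT'⟩ := h'
  refine ⟨f + f', fun l hl => by simp [hf l hl, hf' l hl], rfl, rfl, fun p => ?_⟩
  simp [hT, hT', add_mul, Finset.sum_add_distrib]

lemma smul (h : HasGenre T m u v) (c : ℝ) : HasGenre (c • T) m (c • u) (c • v) := by
  obtain ⟨f, hf, rfl, rfl, hT⟩ := h
  refine ⟨c • f, fun l hl => by simp [hf l hl], rfl, rfl, fun p => ?_⟩
  simp [hT, Finset.smul_sum]

lemma succ (h : HasGenre T m u v) : HasGenre T (m + 1) 0 0 := by
  obtain ⟨f, hf, rfl, rfl, hT⟩ := h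
  refine ⟨f, fun l hl => hf l (by push_cast at hl; omega), hf _ ?_, hf _ ?_, fun p => ?_⟩
  · rw [abs_neg, Nat.abs_cast]; push_cast; omega
  · rw [Nat.abs_cast]; push_cast; omega
  · rw [hT, ← sum_Icc_shift m _ (fun l hl => by rw [hf l hl, zero_mul]) 0 (by simp)]
    simp

lemma threeTerm_mul (h : HasGenre T m u v) (A B G : ℝ[X]) :
    HasGenre (threeTerm A B G * T) (m + 1) (G * taylor (-1) u) (A * taylor 1 v) := by
  obtain ⟨f, hf, rfl, rfl, hT⟩ := h
  refine ⟨fun l => A * taylor 1 (f (l + -1)) + B * f (l + 0) + G * taylor (-1) (f (l + 1)),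
    fun l hl => ?_, ?_, ?_, fun p => ?_⟩
  · push_cast at hl
    dsimp only
    rw [hf (l + -1), hf (l + 0), hf (l + 1)]
    · simp
    all_goals grind
  · simp only [Nat.cast_add, Nat.cast_one]
    rw [hf (_ + -1), hf (_ + 0)]
    · simp
    all_goals grind
  · simp only [Nat.cast_add, Nat.cast_one]
    rw [hf (_ + 1), hf (_ + 0)]
    · simp
    all_goals grind
  · have key (H : ℝ[X]) (j : ℤ) (hj : |j| ≤ 1) :
        ∑ l ∈ Finset.Icc (-((m : ℤ) + 1)) (m + 1),
            H * taylor (-(j : ℝ)) (f (l + j)) * taylor (l : ℝ) p =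
          H * taylor (-(j : ℝ)) (T p) := by
      rw [hT, ← sum_Icc_shift m _ (fun l hl => by rw [hf l hl, zero_mul]) j hj, map_sum,
        Finset.mul_sum]
      refine Finset.sum_congr rfl fun l _ => ?_
      rw [taylor_mul, taylor_taylor, mul_assoc]
      push_cast
      rw [neg_add_cancel_comm_assoc]
    have h1 := key A (-1) (by simp)
    have h2 := key B 0 (by simp)
    have h3 := key G 1 (by simp)
    push_cast at *
    rw [neg_neg] at h1
    simp only [neg_zero, taylor_zero] at h2
    simp only [add_mul, Finset.sum_add_distrib]
    rw [h1, h2, h3, Module.End.mul_apply, threeTerm_apply]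

end HasGenre

lemma hasGenre_one : HasGenre 1 0 1 1 :=
  ⟨fun l => if l = 0 then 1 else 0, fun l hl => by
    have : l ≠ 0 := by rintro rfl; simp at hl
    simp [this], by simp, by simp, fun p => by simp⟩

/-- The coefficient of the lowest shift in the powers of a three term operator. -/
noncomputable def lowCoeff (G : ℝ[X]) : ℕ → ℝ[X]
  | 0 => 1
  | m + 1 => G * taylor (-1) (lowCoeff G m)

lemma hasGenre_threeTerm_pow (α : ℝ) (B G : ℝ[X]) (m : ℕ) :
    HasGenre (threeTerm (C α) B G ^ m) m (lowCoeff G m) (C (α ^ m)) := by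
  induction m with
  | zero => simpa [lowCoeff] using hasGenre_one
  | succ m ih =>
    rw [pow_succ', pow_succ', C_mul, ← taylor_C 1 (α ^ m)]
    exact ih.threeTerm_mul _ _ _

lemma hasGenre_aeval (α : ℝ) (B G R : ℝ[X]) :
    HasGenre (aeval (threeTerm (C α) B G) R) R.natDegree
      (R.leadingCoeff • lowCoeff G R.natDegree) (R.leadingCoeff • C (α ^ R.natDegree)) := by
  have key (m : ℕ) : HasGenre
      (∑ i ∈ Finset.range (m + 1), R.coeff i • threeTerm (C α) B G ^ i) m
      (R.coeff m • lowCoeff G m) (R.coeff m • C (α ^ m)) := by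
    induction m with
    | zero => simpa using (hasGenre_threeTerm_pow α B G 0).smul (R.coeff 0)
    | succ m ih =>
      rw [Finset.sum_range_succ]
      simpa using ih.succ.add ((hasGenre_threeTerm_pow α B G (m + 1)).smul (R.coeff (m + 1)))
  rw [aeval_eq_sum_range]
  exact key _

section Charlier

variable (a : ℝ)

/-- `p(x) ↦ x p(x-1)`, which raises falling factorials. -/
noncomputable def raising : Module.End ℝ ℝ[X] := LinearMap.mulLeft ℝ X ∘ₗ taylor (-1)

lemma raising_apply (p : ℝ[X]) : raising p = X * taylor (-1) p := rfl

lemma raising_pow_one (j : ℕ) :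
    (raising ^ j) 1 = ∏ i ∈ Finset.range j, (X - C (i : ℝ)) := by
  induction j with
  | zero => simp
  | succ j ih =>
    rw [pow_succ', Module.End.mul_apply, ih, raising_apply, Finset.prod_range_succ', mul_comm]
    congr 1
    · change taylorAlgHom (-1 : ℝ) _ = _
      rw [map_prod]
      refine Finset.prod_congr rfl fun i _ => ?_
      change taylor (-1 : ℝ) _ = _
      rw [map_sub, taylor_X, taylor_C]
      push_cast
      simp only [C_neg, C_add, C_1]
      ring
    · simp

lemma charlier_eq (n : ℕ) :
    charlier a n = (n.factorial : ℝ)⁻¹ • ((raising - a • 1) ^ n) 1 := by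
  have hc : Commute raising (-(a • (1 : Module.End ℝ ℝ[X]))) :=
    ((Commute.one_right raising).smul_right a).neg_right
  rw [sub_eq_add_neg, hc.add_pow, charlier, ← smul_eq_C_mul, LinearMap.sum_apply]
  congr 1
  refine Finset.sum_congr rfl fun j _ => ?_
  have h1 : (-(a • (1 : Module.End ℝ ℝ[X]))) ^ (n - j) * (n.choose j : Module.End ℝ ℝ[X]) =
      ((-a) ^ (n - j) * (n.choose j : ℝ)) • 1 := by
    rw [← neg_smul a (1 : Module.End ℝ ℝ[X]), _root_.smul_pow, one_pow, mul_smul,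
      smul_mul_assoc, one_mul]
    congr 1
    rw [← nsmul_one, Nat.cast_smul_eq_nsmul]
  rw [mul_assoc, h1, Module.End.mul_apply, LinearMap.smul_apply, Module.End.one_apply, map_smul,
    raising_pow_one, smul_eq_C_mul]

lemma charlier_zero : charlier a 0 = 1 := by simp [charlier]

lemma charlier_succ (n : ℕ) :
    ((n : ℝ) + 1) • charlier a (n + 1) = X * taylor (-1) (charlier a n) - a • charlier a n := by
  have h : (n : ℝ) + 1 ≠ 0 := by positivity
  rw [charlier_eq, charlier_eq, pow_succ', Module.End.mul_apply, LinearMap.sub_apply,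
    raising_apply, LinearMap.smul_apply, Module.End.one_apply, Nat.factorial_succ, smul_smul]
  push_cast
  rw [mul_inv, mul_inv_cancel_left₀ h, map_smul, smul_sub, mul_smul_comm, smul_comm a]

lemma taylor_neg_one_taylor_one (p : ℝ[X]) : taylor (-1) (taylor 1 p) = p := by
  simp [taylor_taylor]

lemma taylor_one_taylor_neg_one (p : ℝ[X]) : taylor 1 (taylor (-1) p) = p := by
  simp [taylor_taylor]

lemma taylor_one_charlier_succ (n : ℕ) :
    taylor 1 (charlier a (n + 1)) = charlier a (n + 1) + charlier a n := by
  induction n with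
  | zero =>
    have h := charlier_succ a 0
    simp only [charlier_zero, Nat.cast_zero, zero_add, one_smul, taylor_one] at h
    simp [h, charlier_zero]
    ring
  | succ n ih =>
    have hn : ((n + 1 : ℕ) : ℝ) + 1 ≠ 0 := by positivity
    apply smul_right_injective _ hn
    have h := charlier_succ a (n + 1)
    have h0 := charlier_succ a n
    have h' : taylor (-1) (charlier a (n + 1)) =
        charlier a (n + 1) - taylor (-1) (charlier a n) := by
      rw [eq_sub_iff_add_eq, ← map_add, ← ih, taylor_neg_one_taylor_one]
    simp only [smul_add]
    rw [← map_smul, h, map_sub, taylor_mul, taylor_one_taylor_neg_one, taylor_X, map_smul, ih, h']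
    push_cast at hn ⊢
    simp only [smul_eq_C_mul, map_add, map_natCast, map_one] at h0 ⊢
    linear_combination -h0

lemma taylor_neg_one_charlier_succ (n : ℕ) :
    taylor (-1) (charlier a (n + 1)) = charlier a (n + 1) - taylor (-1) (charlier a n) := by
  rw [eq_sub_iff_add_eq, ← map_add, ← taylor_one_charlier_succ, taylor_neg_one_taylor_one]

lemma threeTerm_charlier (n : ℕ) :
    threeTerm (-C a) (X + C a) (-X) (charlier a n) = (n : ℝ) • charlier a n := by
  rw [threeTerm_apply]
  cases n with
  | zero => simp [charlier_zero]
  | succ n =>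
    have h := charlier_succ a n
    rw [taylor_one_charlier_succ, taylor_neg_one_charlier_succ]
    push_cast
    simp only [smul_eq_C_mul, map_add, map_natCast, map_one] at h ⊢
    linear_combination -h

lemma X_mul_charlier_zero : X * charlier a 0 = charlier a 1 + a • charlier a 0 := by
  have h := charlier_succ a 0
  simp only [charlier_zero, Nat.cast_zero, zero_add, one_smul, taylor_one] at h
  simp [h, charlier_zero]

lemma X_mul_charlier_succ (n : ℕ) : X * charlier a (n + 1) =
    ((n : ℝ) + 2) • charlier a (n + 2) + ((n : ℝ) + 1 + a) • charlier a (n + 1) +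
      a • charlier a n := by
  have h := charlier_succ a n
  have h' := charlier_succ a (n + 1)
  rw [taylor_neg_one_charlier_succ] at h'
  push_cast at h'
  simp only [smul_eq_C_mul, map_add, map_natCast, map_one, map_ofNat] at h h' ⊢
  linear_combination -h - h'

lemma charlier_degree (n : ℕ) : (charlier a n).degree = n := by
  induction n with
  | zero => simp [charlier_zero]
  | succ n ih =>
    have hn : (n : ℝ) + 1 ≠ 0 := by positivity
    have h := congrArg degree (charlier_succ a n)
    have h1 : (X * taylor (-1) (charlier a n)).degree = ((n + 1 : ℕ) : WithBot ℕ) := by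
      rw [degree_mul, degree_X, degree_taylor, ih, add_comm]; rfl
    rw [degree_smul_of_smul_regular _ (IsSMulRegular.of_ne_zero hn),
      degree_sub_eq_left_of_degree_lt, h1] at h
    · exact h
    · rw [h1]
      refine (degree_smul_le _ _).trans_lt ?_
      rw [ih]
      exact_mod_cast Nat.lt_succ_self n

end Charlier

section Functional

lemma summable_charlier_weight (a : ℝ) (p : ℝ[X]) :
    Summable fun x : ℕ => a ^ x / x.factorial * p.eval (x : ℝ) := by
  induction p using Polynomial.induction_on' with
  | add p q hp hq => simpa [mul_add] using hp.add hq
  | monomial n c =>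
    have h := ((Real.summable_pow_div_factorial (|a| * Real.exp 1)).mul_left
      (n.factorial : ℝ)).mul_right |c|
    refine Summable.of_norm_bounded h fun x => ?_
    have hx := Real.pow_div_factorial_le_exp _ (Nat.cast_nonneg x : (0 : ℝ) ≤ x) n
    rw [div_le_iff₀' (by positivity)] at hx
    have : Real.exp (x : ℝ) = Real.exp 1 ^ x := by rw [← Real.exp_nat_mul, mul_one]
    rw [this] at hx
    simp only [eval_monomial, norm_mul, norm_div, norm_pow, Real.norm_eq_abs, Nat.abs_cast,
      mul_pow]
    calc |a| ^ x / x.factorial * (|c| * (x : ℝ) ^ n)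
        ≤ |a| ^ x / x.factorial * (|c| * (n.factorial * Real.exp 1 ^ x)) := by gcongr
      _ = _ := by ring

/-- The Charlier moment functional. -/
noncomputable def charlierFunctional (a : ℝ) : ℝ[X] →ₗ[ℝ] ℝ where
  toFun p := ∑' x : ℕ, a ^ x / x.factorial * p.eval (x : ℝ)
  map_add' p q := by
    simp only [eval_add, mul_add]
    exact (summable_charlier_weight a p).tsum_add (summable_charlier_weight a q)
  map_smul' c p := by
    simp only [eval_smul, smul_eq_mul, RingHom.id_apply, ← tsum_mul_left]
    exact tsum_congr fun x => by ring

lemma charlierFunctional_X_mul (a : ℝ) (p : ℝ[X]) :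
    charlierFunctional a (X * p) = a * charlierFunctional a (taylor 1 p) := by
  change ∑' x : ℕ, _ = a * ∑' x : ℕ, _
  rw [(summable_charlier_weight a (X * p)).tsum_eq_zero_add, ← tsum_mul_left]
  simp only [eval_mul, eval_X, Nat.cast_zero, zero_mul, mul_zero, zero_add, taylor_eval]
  refine tsum_congr fun x => ?_
  have : (x : ℝ) + 1 ≠ 0 := by positivity
  rw [Nat.factorial_succ, pow_succ]
  push_cast
  field_simp

lemma degree_taylor_one_sub_lt {q : ℝ[X]} {n : ℕ} (hq : q.degree < (n + 1 : ℕ)) :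
    (taylor 1 q - q).degree < n := by
  by_cases h0 : q = 0
  · simp [h0, bot_lt_iff_ne_bot]
  · have h1 : (taylor 1 q - q).degree < q.degree := by
      rw [← degree_taylor q 1]
      refine degree_sub_lt_left (degree_taylor q 1) ?_ (leadingCoeff_taylor _ _)
      rwa [Ne, taylor_eq_zero]
    refine h1.trans_le ?_
    rw [degree_eq_natDegree h0] at hq ⊢
    exact_mod_cast Nat.lt_succ_iff.mp (by exact_mod_cast hq)

lemma charlierFunctional_charlier_mul (a : ℝ) (n : ℕ) {q : ℝ[X]} (hq : q.degree < n) :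
    charlierFunctional a (charlier a n * q) = 0 := by
  induction n generalizing q with
  | zero =>
    have : q = 0 := degree_eq_bot.mp (Nat.WithBot.lt_zero_iff.mp (by simpa using hq))
    simp [this]
  | succ n ih =>
    have hn : (n : ℝ) + 1 ≠ 0 := by positivity
    have h : ((n : ℝ) + 1) • (charlier a (n + 1) * q) =
        X * (taylor (-1) (charlier a n) * q) - a • (charlier a n * q) := by
      rw [← smul_mul_assoc, charlier_succ, sub_mul, smul_mul_assoc, mul_assoc]
    have h2 := congrArg (charlierFunctional a) h
    rw [map_smul, map_sub, charlierFunctional_X_mul, taylor_mul, taylor_one_taylor_neg_one,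
      map_smul, smul_eq_mul, smul_eq_mul, ← mul_sub, ← map_sub, ← mul_sub,
      ih (degree_taylor_one_sub_lt hq), mul_zero] at h2
    exact (mul_eq_zero.mp h2).resolve_left hn

/-- The annihilator polynomial of `{1, …, k}`. -/
noncomputable def annihilator (k : ℕ) : ℝ[X] := ∏ j ∈ Finset.Icc 1 k, (X - C (j : ℝ))

lemma annihilator_succ (k : ℕ) :
    annihilator (k + 1) = annihilator k * (X - C ((k : ℝ) + 1)) := by
  rw [annihilator, Finset.prod_Icc_succ_top (by omega), ← annihilator]
  push_cast; rfl

lemma charlierFunctional_annihilator_mul (a : ℝ) (k : ℕ) (g : ℝ[X]) :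
    charlierFunctional a (annihilator k * (X * g)) =
      a ^ (k + 1) * charlierFunctional a (taylor ((k : ℝ) + 1) g) := by
  induction k generalizing g with
  | zero => simp [annihilator, charlierFunctional_X_mul]
  | succ k ih =>
    have h := ih ((X - C ((k : ℝ) + 1)) * g)
    rw [taylor_mul, map_sub, taylor_X, taylor_C, add_sub_cancel_right, charlierFunctional_X_mul,
      taylor_taylor] at h
    rw [annihilator_succ]
    calc _ = charlierFunctional a (annihilator k * (X * ((X - C ((k : ℝ) + 1)) * g))) := by
          congr 1; ring
      _ = _ := by
          rw [h]; push_cast; ring_nf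

/-- The Charlier polynomial `c_n^a(x-k-1)`. -/
noncomputable def shiftedCharlier (a : ℝ) (k n : ℕ) : ℝ[X] :=
  taylor (-((k : ℝ) + 1)) (charlier a n)

/-- The polynomial `n ↦ c_k^{-a}(-n-1)`. -/
noncomputable def dualCharlier (a : ℝ) (k : ℕ) : ℝ[X] := (charlier (-a) k).comp (-X - 1)

lemma dualCharlier_eval (a : ℝ) (k : ℕ) (x : ℝ) :
    (dualCharlier a k).eval x = (charlier (-a) k).eval (-x - 1) := by
  simp [dualCharlier]

lemma dualCharlier_succ_eval (a : ℝ) (k : ℕ) (x : ℝ) :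
    (dualCharlier a (k + 1)).eval (x - 1) =
      (dualCharlier a (k + 1)).eval x + (dualCharlier a k).eval x := by
  have h := congrArg (eval (-x - 1)) (taylor_one_charlier_succ (-a) k)
  rw [taylor_eval, eval_add] at h
  rw [dualCharlier_eval, dualCharlier_eval, dualCharlier_eval, ← h]
  ring_nf

lemma dualCharlier_difference (a : ℝ) (k : ℕ) (x : ℝ) :
    a * (dualCharlier a k).eval (x - 1) + (x + 1) * (dualCharlier a k).eval (x + 1) =
      (k + x + 1 + a) * (dualCharlier a k).eval x := by
  have h := congrArg (eval (-x - 1)) (threeTerm_charlier (-a) k)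
  simp only [threeTerm_apply, eval_add, eval_mul, taylor_eval, eval_smul, eval_neg, eval_X, eval_C,
    smul_eq_mul] at h
  simp only [dualCharlier_eval]
  rw [show -(x - 1) - 1 = -x - 1 + 1 by ring, show -(x + 1) - 1 = -x - 1 + -1 by ring]
  linear_combination h

lemma dualCharlier_succ_eval_neg_one (a : ℝ) (k : ℕ) :
    (k + 1) * (dualCharlier a (k + 1)).eval (-1) = a * (dualCharlier a k).eval (-1) := by
  have h := congrArg (eval 0) (charlier_succ (-a) k)
  simp only [eval_smul, eval_sub, eval_mul, eval_X, zero_mul, smul_eq_mul] at h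
  simp only [dualCharlier_eval, sub_self, neg_neg]
  linear_combination h

lemma shiftedCharlier_succ_left (a : ℝ) (k n : ℕ) :
    (X - C ((k : ℝ) + 1)) * shiftedCharlier a k n =
      taylor (-((k : ℝ) + 1)) (X * charlier a n) := by
  rw [shiftedCharlier, taylor_mul, taylor_X, C_neg, sub_eq_add_neg]

lemma shiftedCharlier_succ_add (a : ℝ) (k n : ℕ) :
    shiftedCharlier a (k + 1) (n + 1) + shiftedCharlier a (k + 1) n =
      shiftedCharlier a k (n + 1) := by
  simp only [shiftedCharlier]
  rw [← map_add, ← taylor_one_charlier_succ, taylor_taylor]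
  push_cast; ring_nf

lemma taylor_one_shiftedCharlier_succ (a : ℝ) (k n : ℕ) :
    taylor 1 (shiftedCharlier a k (n + 1)) =
      shiftedCharlier a k (n + 1) + shiftedCharlier a k n := by
  simp only [shiftedCharlier]
  rw [← map_add, ← taylor_one_charlier_succ, taylor_taylor, taylor_taylor, add_comm]

lemma shiftedCharlier_zero (a : ℝ) (k : ℕ) : shiftedCharlier a k 0 = 1 := by
  simp [shiftedCharlier, charlier_zero]

lemma shiftedCharlier_degree (a : ℝ) (k n : ℕ) : (shiftedCharlier a k n).degree = n := by
  rw [shiftedCharlier, degree_taylor, charlier_degree]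

lemma charlierFunctional_annihilator_shiftedCharlier (a : ℝ) (k n : ℕ) :
    charlierFunctional a (annihilator k * shiftedCharlier a k n) =
      (-1) ^ n * charlierFunctional a 1 * k.factorial * (dualCharlier a k).eval (n : ℝ) := by
  induction k generalizing n with
  | zero =>
    have hz : dualCharlier a 0 = 1 := by simp [dualCharlier, charlier_zero]
    simp only [annihilator, hz]
    induction n with
    | zero => simp [shiftedCharlier_zero]
    | succ n ih =>
      have h0 := charlierFunctional_charlier_mul a (n + 1) (q := 1) (by simp; positivity)
      have h1 : shiftedCharlier a 0 (n + 1) = charlier a (n + 1) - shiftedCharlier a 0 n := by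
        rw [eq_sub_iff_add_eq, ← taylor_one_shiftedCharlier_succ, shiftedCharlier, taylor_taylor]
        simp
      rw [mul_one] at h0
      simp at ih ⊢
      rw [h1, map_sub, h0, ih]
      ring
  | succ k ih =>
    have rec0 (n : ℕ) : annihilator (k + 1) * shiftedCharlier a k n =
        annihilator k * taylor (-((k : ℝ) + 1)) (X * charlier a n) := by
      rw [annihilator_succ, mul_assoc, shiftedCharlier_succ_left]
    induction n with
    | zero =>
      have h0 : shiftedCharlier a (k + 1) 0 = shiftedCharlier a k 0 := by
        simp [shiftedCharlier_zero]
      have h1 := ih 1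
      have h2 := ih 0
      have h3 := dualCharlier_difference a k 0
      have h4 := dualCharlier_succ_eval_neg_one a k
      have h5 := dualCharlier_succ_eval a k 0
      rw [h0, rec0, X_mul_charlier_zero, map_add, map_smul, ← shiftedCharlier, ← shiftedCharlier,
        mul_add, mul_smul_comm, map_add, map_smul, h1, h2, Nat.factorial_succ, smul_eq_mul]
      push_cast at *
      simp only [zero_sub, zero_add, pow_one, pow_zero] at *
      linear_combination charlierFunctional a 1 * (k.factorial : ℝ) * (-h3 - h4 + (k + 1) * h5)
    | succ n ihn =>
      have h0 : shiftedCharlier a (k + 1) (n + 1) =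
          shiftedCharlier a k (n + 1) - shiftedCharlier a (k + 1) n :=
        eq_sub_iff_add_eq.mpr (shiftedCharlier_succ_add a k n)
      have h1 := ih (n + 2)
      have h2 := ih (n + 1)
      have h3 := ih n
      have h4 := dualCharlier_difference a k (n + 1)
      have h5 := dualCharlier_succ_eval a k (n + 1)
      rw [h0, mul_sub, map_sub, ihn, rec0, X_mul_charlier_succ]
      rw [shiftedCharlier] at h1 h2 h3
      simp only [map_add, map_smul, mul_add, mul_smul_comm, smul_eq_mul]
      rw [h1, h2, h3, Nat.factorial_succ]
      push_cast at *
      rw [add_sub_cancel_right] at h4 h5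
      rw [show (n : ℝ) + 1 + 1 = n + 2 by ring] at h4
      simp only [pow_succ] at *
      linear_combination charlierFunctional a 1 * (k.factorial : ℝ) * (-1) ^ n *
        (h4 - (k + 1) * h5)

end Functional

section Orthogonality

variable {Λ : ℝ[X] →ₗ[ℝ] ℝ}

lemma map_mul_eq_zero_of_degree_lt {q p : ℝ[X]} {n : ℕ}
    (hq : ∀ m < n, Λ (q * X ^ m) = 0) (hp : p.degree < n) : Λ (q * p) = 0 := by
  by_cases h0 : p = 0
  · simp [h0]
  · rw [p.as_sum_range_C_mul_X_pow, Finset.mul_sum, map_sum]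
    refine Finset.sum_eq_zero fun i hi => ?_
    rw [← smul_eq_C_mul, mul_smul_comm, map_smul, hq i, smul_zero]
    have := (natDegree_lt_iff_degree_lt h0).mpr hp
    have := Finset.mem_range.mp hi
    omega

lemma exists_eq_smul_of_orthogonal {r : ℕ → ℝ[X]} (hdeg : ∀ n : ℕ, (r n).degree = n)
    (horth : ∀ n m : ℕ, m < n → Λ (r n * X ^ m) = 0) (hnd : ∀ n : ℕ, Λ (r n * X ^ n) ≠ 0)
    {q : ℝ[X]} {n : ℕ} (hq : q.degree = n) (hqo : ∀ m < n, Λ (q * X ^ m) = 0) :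
    ∃ c : ℝ, r n = c • q := by
  have hq0 : q ≠ 0 := by rintro rfl; simp at hq
  have hr0 : r n ≠ 0 := by intro h; have := hdeg n; simp [h] at this
  have hc : (r n).leadingCoeff / q.leadingCoeff ≠ 0 := by simp [hq0, hr0]
  refine ⟨(r n).leadingCoeff / q.leadingCoeff, ?_⟩
  set c := (r n).leadingCoeff / q.leadingCoeff with c_def
  have hcq : (c • q).degree = n := by
    rw [degree_smul_of_smul_regular _ (IsSMulRegular.of_ne_zero hc), hq]
  by_contra hne
  set s := r n - c • q with s_def
  have hs0 : s ≠ 0 := sub_ne_zero.mpr hne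
  have hsdeg : s.degree < n := by
    rw [← hdeg n]
    refine degree_sub_lt_left ((hdeg n).trans hcq.symm) hr0 ?_
    rw [smul_eq_C_mul, leadingCoeff_mul, leadingCoeff_C, c_def,
      div_mul_cancel₀ _ (leadingCoeff_ne_zero.mpr hq0)]
  have hso : ∀ m < n, Λ (s * X ^ m) = 0 := fun m hm => by
    rw [s_def, sub_mul, map_sub, horth n m hm, smul_mul_assoc, map_smul, hqo m hm]; simp
  have h1 : Λ (s * r s.natDegree) = 0 := by
    refine map_mul_eq_zero_of_degree_lt hso ?_
    rwa [hdeg, ← degree_eq_natDegree hs0]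
  have h2 : Λ (r s.natDegree * s.eraseLead) = 0 :=
    map_mul_eq_zero_of_degree_lt (horth _) <| by
      rw [← degree_eq_natDegree hs0]; exact degree_eraseLead_lt hs0
  have h3 : s * r s.natDegree = r s.natDegree * s.eraseLead +
      s.leadingCoeff • (r s.natDegree * X ^ s.natDegree) := by
    rw [smul_eq_C_mul]
    linear_combination -r s.natDegree * s.eraseLead_add_C_mul_X_pow
  rw [h3, map_add, h2, zero_add, map_smul, smul_eq_zero] at h1
  exact h1.elim (leadingCoeff_ne_zero.mpr hs0) (hnd _)

end Orthogonality

/-- The Charlier operator in the variable `x - k - 1`. -/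
noncomputable def shiftedCharlierOp (a : ℝ) (k : ℕ) : Module.End ℝ ℝ[X] :=
  threeTerm (C (-a)) (X - C ((k : ℝ) + 1) + C a) (-(X - C ((k : ℝ) + 1)))

lemma shiftedCharlierOp_apply (a : ℝ) (k n : ℕ) :
    shiftedCharlierOp a k (shiftedCharlier a k n) = (n : ℝ) • shiftedCharlier a k n := by
  rw [shiftedCharlier, ← map_smul, ← threeTerm_charlier, shiftedCharlierOp, threeTerm_apply,
    threeTerm_apply]
  simp only [map_add, taylor_mul, map_neg, taylor_X, taylor_C, taylor_taylor]
  rw [add_comm 1, add_comm (-1 : ℝ), ← sub_eq_add_neg X]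

lemma aeval_shiftedCharlierOp_apply (a : ℝ) (k n : ℕ) (R : ℝ[X]) :
    aeval (shiftedCharlierOp a k) R (shiftedCharlier a k n) =
      R.eval (n : ℝ) • shiftedCharlier a k n :=
  Module.End.aeval_apply_of_mem_apply_eq_smul (shiftedCharlierOp_apply a k n)

/-- The polynomial `n ↦ -c_{k+1}^{-a}(-n)`, a summation of `dualCharlier`. -/
noncomputable def eigenvaluePoly (a : ℝ) (k : ℕ) : ℝ[X] := -(charlier (-a) (k + 1)).comp (-X)

lemma eigenvaluePoly_eval_add_one (a : ℝ) (k : ℕ) (x : ℝ) :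
    (eigenvaluePoly a k).eval (x + 1) = (eigenvaluePoly a k).eval x + (dualCharlier a k).eval x := by
  have h := congrArg (eval (-x - 1)) (taylor_one_charlier_succ (-a) k)
  rw [taylor_eval, eval_add, sub_add_cancel] at h
  simp only [eigenvaluePoly, eval_neg, eval_comp, eval_X, dualCharlier_eval, h]
  rw [neg_add']
  ring

lemma charlier_natDegree (a : ℝ) (n : ℕ) : (charlier a n).natDegree = n :=
  natDegree_eq_of_degree_eq_some (charlier_degree a n)

lemma dualCharlier_natDegree (a : ℝ) (k : ℕ) : (dualCharlier a k).natDegree = k := by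
  have h : (-X - 1 : ℝ[X]).natDegree = 1 := by
    rw [← neg_add', natDegree_neg, ← C_1, natDegree_X_add_C]
  rw [dualCharlier, natDegree_comp, h, mul_one, charlier_natDegree]

lemma dualCharlier_ne_zero (a : ℝ) (k : ℕ) : dualCharlier a k ≠ 0 := by
  rcases Nat.eq_zero_or_pos k with rfl | hk
  · simp [dualCharlier, charlier_zero]
  · exact ne_zero_of_natDegree_gt ((dualCharlier_natDegree a k).symm ▸ hk)

lemma eigenvaluePoly_natDegree (a : ℝ) (k : ℕ) : (eigenvaluePoly a k).natDegree = k + 1 := by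
  rw [eigenvaluePoly, natDegree_neg, natDegree_comp, natDegree_neg, natDegree_X, mul_one,
    charlier_natDegree]

lemma eigenvaluePoly_ne_zero (a : ℝ) (k : ℕ) : eigenvaluePoly a k ≠ 0 :=
  ne_zero_of_natDegree_gt (n := 0) (by rw [eigenvaluePoly_natDegree]; exact k.succ_pos)

lemma lowCoeff_eval_ne_zero (c : ℝ) (m : ℕ) {x : ℝ} (hx : x < c) :
    (lowCoeff (-(X - C c)) m).eval x ≠ 0 := by
  induction m generalizing x with
  | zero => simp [lowCoeff]
  | succ m ih =>
    rw [lowCoeff, eval_mul, taylor_eval]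
    refine mul_ne_zero ?_ (ih (by linarith))
    simp [sub_eq_zero, hx.ne']

/-- The difference operator of order `2k+2` diagonalized by the Krall-Charlier polynomials. -/
noncomputable def krallCharlierOp (a : ℝ) (k : ℕ) : Module.End ℝ ℝ[X] :=
  aeval (shiftedCharlierOp a k) (eigenvaluePoly a k) +
    threeTerm 0 1 (-1) * aeval (shiftedCharlierOp a k) (dualCharlier a k)

lemma hasGenre_krallCharlierOp {a : ℝ} (ha : a ≠ 0) (k : ℕ) :
    ∃ u v, u ≠ 0 ∧ v ≠ 0 ∧ HasGenre (krallCharlierOp a k) (k + 1) u v := by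
  have h1 := hasGenre_aeval (-a) (X - C ((k : ℝ) + 1) + C a) (-(X - C ((k : ℝ) + 1)))
    (eigenvaluePoly a k)
  have h2 := (hasGenre_aeval (-a) (X - C ((k : ℝ) + 1) + C a) (-(X - C ((k : ℝ) + 1)))
    (dualCharlier a k)).threeTerm_mul 0 1 (-1)
  rw [eigenvaluePoly_natDegree] at h1
  rw [dualCharlier_natDegree] at h2
  refine ⟨_, _, fun h => ?_, ?_, h1.add h2⟩
  · have h := congrArg (eval ((k : ℝ) + 1)) h
    have h3 := lowCoeff_eval_ne_zero ((k : ℝ) + 1) k (lt_add_one (k : ℝ))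
    rw [lowCoeff] at h
    simp [dualCharlier_ne_zero, taylor_eval] at h
    exact h3 (by simpa using h)
  · rw [zero_mul, add_zero, smul_eq_C_mul, ← C_mul]
    simp [eigenvaluePoly_ne_zero, ha]

/-- A scalar multiple of the `n`-th Krall-Charlier polynomial. -/
noncomputable def krallCharlier (a : ℝ) (k : ℕ) : ℕ → ℝ[X]
  | 0 => 1
  | n + 1 => (dualCharlier a k).eval (n : ℝ) • shiftedCharlier a k (n + 1) +
      (dualCharlier a k).eval ((n : ℝ) + 1) • shiftedCharlier a k n

lemma krallCharlierOp_apply (a : ℝ) (k n : ℕ) :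
    krallCharlierOp a k (krallCharlier a k n) =
      (eigenvaluePoly a k).eval (n : ℝ) • krallCharlier a k n := by
  cases n with
  | zero =>
    rw [krallCharlierOp, krallCharlier, ← shiftedCharlier_zero a k, LinearMap.add_apply,
      Module.End.mul_apply, aeval_shiftedCharlierOp_apply, aeval_shiftedCharlierOp_apply,
      threeTerm_apply, shiftedCharlier_zero, map_smul, taylor_one]
    simp
  | succ n =>
    have h := taylor_neg_one_taylor_one (shiftedCharlier a k (n + 1))
    rw [taylor_one_shiftedCharlier_succ, map_add, ← eq_sub_iff_add_eq] at h
    have hR := eigenvaluePoly_eval_add_one a k n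
    rw [krallCharlierOp, krallCharlier, LinearMap.add_apply, Module.End.mul_apply]
    simp only [map_add, map_smul, aeval_shiftedCharlierOp_apply, threeTerm_apply]
    rw [h]
    push_cast
    rw [hR]
    simp only [smul_eq_C_mul, C_add]
    ring

lemma krallCharlier_degree (a : ℝ) (k n : ℕ)
    (h : ∀ n : ℕ, (dualCharlier a k).eval (n : ℝ) ≠ 0) : (krallCharlier a k n).degree = n := by
  cases n with
  | zero => simp [krallCharlier]
  | succ n =>
    have h1 : ((dualCharlier a k).eval (n : ℝ) • shiftedCharlier a k (n + 1)).degree =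
        (n + 1 : ℕ) := by
      rw [degree_smul_of_smul_regular _ (IsSMulRegular.of_ne_zero (h n)), shiftedCharlier_degree]
    rw [krallCharlier, degree_add_eq_left_of_degree_lt, h1]
    rw [h1]
    refine (degree_smul_le _ _).trans_lt ?_
    rw [shiftedCharlier_degree]
    exact_mod_cast n.lt_succ_self

lemma charlierFunctional_annihilator_shiftedCharlier_mul_X_pow (a : ℝ) (k : ℕ) {n m : ℕ}
    (hm : m < n) :
    charlierFunctional a (annihilator k * (shiftedCharlier a k n * X ^ (m + 1))) = 0 := by
  have h := charlierFunctional_annihilator_mul a k (shiftedCharlier a k n * X ^ m)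
  rw [taylor_mul, shiftedCharlier, taylor_taylor, add_neg_cancel, taylor_zero,
    charlierFunctional_charlier_mul a n (by rw [degree_taylor, degree_X_pow]; exact_mod_cast hm),
    mul_zero] at h
  rw [← h, shiftedCharlier]
  congr 1; ring

lemma charlierFunctional_annihilator_krallCharlier (a : ℝ) (k : ℕ) {n m : ℕ} (hm : m < n) :
    charlierFunctional a (annihilator k * (krallCharlier a k n * X ^ m)) = 0 := by
  obtain ⟨n, rfl⟩ := Nat.exists_eq_succ_of_ne_zero (Nat.ne_zero_of_lt hm)
  rw [Nat.succ_eq_add_one, krallCharlier, add_mul, mul_add, smul_mul_assoc, smul_mul_assoc,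
    mul_smul_comm, mul_smul_comm, map_add, map_smul, map_smul]
  cases m with
  | zero =>
    rw [pow_zero, mul_one, mul_one, charlierFunctional_annihilator_shiftedCharlier,
      charlierFunctional_annihilator_shiftedCharlier]
    push_cast
    simp only [smul_eq_mul]
    ring
  | succ m =>
    rw [charlierFunctional_annihilator_shiftedCharlier_mul_X_pow a k (by omega),
      charlierFunctional_annihilator_shiftedCharlier_mul_X_pow a k (by omega)]
    simp

/-- Corollary 4.5: the orthogonal polynomials with respect to the Charlier measure
multiplied by `∏_{j=1}^k (x-j)` are common eigenfunctions of a difference operator of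
order `2k+2` and genre `(-k-1, k+1)`. -/
theorem stmt8 (k : ℕ) (hk : 1 ≤ k) (a : ℝ) (ha : a ≠ 0)
    (hnz : ∀ n : ℕ, 1 ≤ n → (charlier (-a) k).eval (-(n : ℝ)) ≠ 0)
    (L : ℝ[X] → ℝ)
    (hL : ∀ p : ℝ[X], L p =
      ∑' x : ℕ, (∏ j ∈ Finset.Icc 1 k, ((x : ℝ) - j)) * (a^x / x.factorial) * p.eval (x : ℝ))
    (r : ℕ → ℝ[X]) (hdeg : ∀ n : ℕ, (r n).degree = n)
    (horth : ∀ n m : ℕ, m < n → L (r n * X^m) = 0)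
    (hnd : ∀ n : ℕ, L (r n * X^n) ≠ 0) :
    ∃ f : ℤ → ℝ[X], ∃ lam : ℕ → ℝ,
      f (-(k+1 : ℤ)) ≠ 0 ∧ f (k+1 : ℤ) ≠ 0 ∧
      ∀ n : ℕ, ∀ x : ℝ,
        ∑ l ∈ Finset.Icc (-(k+1 : ℤ)) (k+1 : ℤ), (f l).eval x * (r n).eval (x + (l : ℝ))
          = lam n * (r n).eval x := by
  have hZ (n : ℕ) : (dualCharlier a k).eval (n : ℝ) ≠ 0 := by
    rw [dualCharlier_eval, ← neg_add']
    exact_mod_cast hnz (n + 1) (by omega)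
  have hLΛ (p : ℝ[X]) :
      L p = (charlierFunctional a ∘ₗ LinearMap.mulLeft ℝ (annihilator k)) p := by
    rw [hL]
    refine tsum_congr fun x => ?_
    simp only [LinearMap.mulLeft_apply, annihilator, eval_mul, eval_prod, eval_sub, eval_X, eval_C]
    ring
  simp only [hLΛ] at horth hnd
  obtain ⟨u, v, hu, hv, f, -, rfl, rfl, hf⟩ := hasGenre_krallCharlierOp ha k
  refine ⟨f, fun n => (eigenvaluePoly a k).eval (n : ℝ), by simpa using hu, by simpa using hv,
    fun n x => ?_⟩
  obtain ⟨c, hc⟩ := exists_eq_smul_of_orthogonal hdeg horth hnd (krallCharlier_degree a k n hZ)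
    (fun m hm => charlierFunctional_annihilator_krallCharlier a k hm)
  have h : krallCharlierOp a k (r n) = (eigenvaluePoly a k).eval (n : ℝ) • r n := by
    rw [hc, map_smul, krallCharlierOp_apply, smul_comm]
  rw [hf] at h
  simpa [eval_finsetSum, taylor_eval] using congrArg (eval x) h
end

section
/- Let k ≥ 1 be an integer, let a be real with 0 < |a| < 1, and let c be a real number such that c − k − 1 is not a nonpositive integer (i.e. c ∉ {k+1, k, k−1, …}). Then for every n ≥ 0, (1−a)^{c−k−1} · Σ_{x=0}^{∞} [a^x · Γ(x+c) / ((x+c−k−1)·x!)] · m_n^{a,c}(x) = (−1)^k · k! · Γ(c−k−1) · m_k^{1/a, 2−c}(−n−1) / (1−a)^{k}, where the series converges absolutely, Γ is the real Gamma function, and (1−a)^{c−k−1} is the real power of the positive number 1−a. -/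
open Polynomial

/-- The generalized binomial coefficient `binom(y, j) = y(y-1)⋯(y-j+1)/j!` as a polynomial
in the (polynomial) argument `y`. -/
noncomputable def pbinom (y : ℝ[X]) (j : ℕ) : ℝ[X] :=
  C ((j.factorial : ℝ))⁻¹ * ∏ i ∈ Finset.range j, (y - C (i : ℝ))

/-- The Meixner polynomial `m_n^{a,c}(x) = (-1)^n ∑_{j=0}^n a^{-j} binom(x,j) binom(-x-c, n-j)`. -/
noncomputable def meixner (a c : ℝ) (n : ℕ) : ℝ[X] :=
  C ((-1:ℝ)^n) * ∑ j ∈ Finset.range (n+1),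
    C (a⁻¹ ^ j) * pbinom X j * pbinom (-X - C c) (n-j)

theorem choose_neg_eq_multichoose (t : ℝ) (m : ℕ) :
    Ring.choose (-t) m = (-1 : ℝ) ^ m * Ring.multichoose t m := by
  rw [Ring.choose_neg', Units.smul_def, Int.coe_negOnePow_natCast]
  simp

open Finset in
/-- The Chu-Vandermonde identity for `Ring.multichoose`. -/
theorem multichoose_add_eq_sum (r s : ℝ) (k : ℕ) :
    Ring.multichoose (r + s) k =
      ∑ p ∈ antidiagonal k, Ring.multichoose r p.1 * Ring.multichoose s p.2 := by
  have h := Ring.add_choose_eq k (Commute.all (-r) (-s))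
  rw [← neg_add, choose_neg_eq_multichoose] at h
  have h2 :
      ∑ p ∈ antidiagonal k, Ring.choose (-r) p.1 * Ring.choose (-s) p.2 =
        (-1 : ℝ) ^ k * ∑ p ∈ antidiagonal k, Ring.multichoose r p.1 * Ring.multichoose s p.2 := by
    rw [mul_sum]
    refine sum_congr rfl fun p hp => ?_
    rw [choose_neg_eq_multichoose, choose_neg_eq_multichoose,
      ← mem_antidiagonal.mp hp, pow_add]
    ring
  rw [h2] at h
  exact mul_left_cancel₀ (by simp) h

theorem eval_pbinom (p : ℝ[X]) (j : ℕ) (x : ℝ) :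
    (pbinom p j).eval x = Ring.choose (p.eval x) j := by
  rw [Ring.choose_eq_smul, pbinom, eval_mul, eval_C, eval_prod, smul_eq_mul]
  congr 1
  rw [← Polynomial.aeval_eq_smeval, ← Polynomial.eval_map_algebraMap, descPochhammer_map,
    descPochhammer_eval_eq_prod_range]
  simp

theorem Gamma_add_nat (b : ℝ) (hb : ∀ m : ℕ, b ≠ -(m : ℝ)) (s : ℕ) :
    Real.Gamma (b + s) = Real.Gamma b * (s.factorial * Ring.multichoose b s) := by
  induction s with
  | zero => simp
  | succ s ih =>
    have h : b + s ≠ 0 := fun h => hb s (by linarith)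
    have h2 (n : ℕ) := Ring.factorial_nsmul_multichoose_eq_ascPochhammer b n
    simp only [nsmul_eq_mul] at h2
    rw [h2] at ih ⊢
    push_cast
    rw [← add_assoc, Real.Gamma_add_one h, ih, Polynomial.ascPochhammer_smeval_eq_eval,
      Polynomial.ascPochhammer_smeval_eq_eval, ascPochhammer_succ_eval]
    ring

/-- The binomial series `∑ (b)_x a ^ x / x! = (1 - a) ^ (-b)`. -/
theorem hasSum_multichoose (a b : ℝ) (ha : |a| < 1) :
    HasSum (fun x : ℕ => a ^ x * Ring.multichoose b x) ((1 - a) ^ (-b)) := by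
  have h := (Real.one_div_one_sub_rpow_hasFPowerSeriesOnBall_zero b).hasSum (y := a)
    (by simpa [enorm_eq_nnnorm, ← NNReal.coe_lt_coe] using ha)
  have h1 : 0 < 1 - a := by linarith [(abs_lt.mp ha).2]
  rw [zero_add, one_div, ← Real.rpow_neg h1.le] at h
  refine h.congr_fun fun x => ?_
  simp [Ring.multichoose_eq, FormalMultilinearSeries.ofScalars, mul_comm]

theorem hasSum_Gamma (a b : ℝ) (ha : |a| < 1) (hb : ∀ m : ℕ, b ≠ -(m : ℝ)) :
    HasSum (fun x : ℕ => a ^ x * Real.Gamma (x + b) / x.factorial)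
      (Real.Gamma b * (1 - a) ^ (-b)) := by
  refine ((hasSum_multichoose a b ha).mul_left (Real.Gamma b)).congr_fun fun x => ?_
  have : (x.factorial : ℝ) ≠ 0 := by positivity
  rw [add_comm, Gamma_add_nat b hb]
  field_simp

theorem hasSum_Gamma_choose (a b : ℝ) (ha : |a| < 1) (hb : ∀ m : ℕ, b ≠ -(m : ℝ)) (i j : ℕ) :
    HasSum (fun x : ℕ => a ^ x * Real.Gamma (x + b + i) / x.factorial * (x.choose j : ℝ))
      (a ^ j / j.factorial * (Real.Gamma (b + (i + j : ℕ)) * (1 - a) ^ (-(b + (i + j : ℕ))))) := by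
  rw [← hasSum_nat_add_iff' j, Finset.sum_eq_zero, sub_zero]
  · have hb' : ∀ m : ℕ, b + (i + j : ℕ) ≠ -(m : ℝ) := fun m h =>
      hb (m + (i + j)) (by push_cast at h ⊢; linarith)
    refine ((hasSum_Gamma a _ ha hb').mul_left (a ^ j / j.factorial)).congr_fun fun x => ?_
    have h1 : (x.factorial : ℝ) ≠ 0 := by positivity
    have h2 : (j.factorial : ℝ) ≠ 0 := by positivity
    have h3 : ((x + j).factorial : ℝ) ≠ 0 := by positivity
    have h4 : ((x + j).choose j : ℝ) * (x.factorial * j.factorial) = (x + j).factorial := by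
      have := Nat.add_choose_mul_factorial_mul_factorial x j
      rw [← this]
      push_cast
      ring
    have h5 : ((x + j : ℕ) : ℝ) + b + i = x + (b + (i + j : ℕ)) := by push_cast; ring
    rw [h5, pow_add, ← h4]
    have h6 : ((x + j).choose j : ℝ) ≠ 0 := by
      exact_mod_cast (Nat.choose_pos (Nat.le_add_left j x)).ne'
    field_simp
  · intro x hx
    rw [Nat.choose_eq_zero_of_lt (Finset.mem_range.mp hx)]
    simp

theorem Gamma_div_eq_sum (y : ℝ) (hy : ∀ m : ℕ, y ≠ -(m : ℝ)) (N : ℕ) :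
    Real.Gamma (y + N + 1) / y =
      ∑ i ∈ Finset.range (N + 1), (N.factorial : ℝ) / i.factorial * Real.Gamma (y + i) := by
  have hy0 : y ≠ 0 := by simpa using hy 0
  induction N with
  | zero => simp [Real.Gamma_add_one hy0, hy0]
  | succ N ih =>
    have h : y + N + 1 ≠ 0 := fun h => hy (N + 1) (by push_cast; linarith)
    have h1 : ((N + 1).factorial : ℝ) ≠ 0 := by positivity
    rw [Finset.sum_range_succ, div_self h1, one_mul]
    have h2 : ∑ i ∈ Finset.range (N + 1), ((N + 1).factorial : ℝ) / i.factorial *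
        Real.Gamma (y + i) = (N + 1) * (Real.Gamma (y + N + 1) / y) := by
      rw [ih, Finset.mul_sum]
      refine Finset.sum_congr rfl fun i _ => ?_
      rw [Nat.factorial_succ]
      push_cast
      ring
    rw [h2]
    push_cast
    rw [← add_assoc, Real.Gamma_add_one h]
    field_simp
    ring

theorem multichoose_natCast_succ (m n : ℕ) :
    Ring.multichoose ((m : ℝ) + 1) n = (m + n).choose n := by
  rw [Ring.multichoose_eq, ← Ring.choose_natCast]
  push_cast
  ring_nf

theorem multichoose_neg_natCast (s j : ℕ) :
    Ring.multichoose (-(s : ℝ)) j = (-1) ^ j * (s.choose j : ℝ) := by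
  rw [← Ring.choose_natCast, ← neg_neg (s : ℝ), choose_neg_eq_multichoose, ← mul_assoc, ← pow_add,
    Even.neg_one_pow ⟨j, rfl⟩, neg_neg, one_mul]

/-- The convolution of `(1 - z) ^ s` with `(1 - z) ^ (-k - 1)` at degree `n`. -/
theorem sum_alternating_choose (k n s : ℕ) :
    ∑ j ∈ Finset.range (n + 1), (-1 : ℝ) ^ j * s.choose j * ((k + (n - j)).choose (n - j)) =
      Ring.multichoose ((k : ℝ) + 1 - s) n := by
  rw [sub_eq_neg_add, multichoose_add_eq_sum, Finset.Nat.sum_antidiagonal_eq_sum_range_succ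
    (fun i j => Ring.multichoose (-(s : ℝ)) i * Ring.multichoose ((k : ℝ) + 1) j)]
  refine Finset.sum_congr rfl fun j _ => ?_
  rw [multichoose_neg_natCast, multichoose_natCast_succ]

theorem multichoose_sub_of_le (k n s : ℕ) (h : s ≤ k) :
    Ring.multichoose ((k : ℝ) + 1 - s) n = (k - s + n).choose n := by
  rw [← multichoose_natCast_succ, Nat.cast_sub h]
  ring_nf

theorem multichoose_sub_eq_zero (k n s : ℕ) (h : k < s) (h' : s ≤ k + n) :
    Ring.multichoose ((k : ℝ) + 1 - s) n = 0 := by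
  have : (k : ℝ) + 1 - s = -((s - (k + 1) : ℕ) : ℝ) := by
    rw [Nat.cast_sub h]; push_cast; ring
  rw [this, multichoose_neg_natCast, Nat.choose_eq_zero_of_lt (by omega)]
  simp

theorem sum_choose_mul_multichoose (a b : ℝ) (k n : ℕ) :
    ∑ s ∈ Finset.range (k + 1),
      Ring.multichoose b s * ((k - s + n).choose n) * (1 - a) ^ (k - s) =
    ∑ j ∈ Finset.range (k + 1),
      (-a) ^ j * ((n + j).choose j) * Ring.multichoose (b + (n + j : ℕ) + 1) (k - j) := by
  have h1 : ∀ j, Ring.multichoose (b + (n + j : ℕ) + 1) (k - j) =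
      ∑ s ∈ Finset.range (k - j + 1),
        Ring.multichoose b s * ((n + j + (k - j - s)).choose (k - j - s)) := by
    intro j
    rw [add_assoc, multichoose_add_eq_sum, Finset.Nat.sum_antidiagonal_eq_sum_range_succ
      (fun p q => Ring.multichoose b p * Ring.multichoose (((n + j : ℕ) : ℝ) + 1) q)]
    simp only [multichoose_natCast_succ]
  have h2 : ∀ s, (1 - a) ^ (k - s) =
      ∑ j ∈ Finset.range (k - s + 1), (-a) ^ j * ((k - s).choose j : ℝ) := by
    intro s
    rw [sub_eq_neg_add, add_pow]
    simp
  simp only [h1, h2, Finset.mul_sum]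
  rw [Finset.sum_comm' (t' := Finset.range (k + 1)) (s' := fun j => Finset.range (k - j + 1))
    (by simp only [Finset.mem_range]; omega)]
  refine Finset.sum_congr rfl fun j hj => Finset.sum_congr rfl fun s hs => ?_
  simp only [Finset.mem_range] at hj hs
  obtain ⟨t, rfl⟩ : ∃ t, k = s + j + t := ⟨k - s - j, by omega⟩
  have e1 : s + j + t - s = j + t := by omega
  have e2 : s + j + t - j - s = t := by omega
  rw [e1, e2]
  have e3 : ((j + t + n).choose n : ℝ) * ((j + t).choose j) =
      (n + j).choose j * (n + j + t).choose t := by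
    rw [← Nat.choose_symm_add, ← Nat.choose_symm_add, ← Nat.choose_symm_add]
    simp only [Nat.cast_add_choose]
    rw [show n + j + t = j + t + n by omega]
    field_simp
  linear_combination (Ring.multichoose b s * (-a) ^ j) * e3

theorem double_sum_eq (a b : ℝ) (ha : 1 - a ≠ 0) (k n : ℕ) :
    ∑ j ∈ Finset.range (n + 1), ∑ i ∈ Finset.range (k + (n - j) + 1),
      (-1 : ℝ) ^ j * ((k + (n - j)).choose (n - j)) * ((i + j).choose j) *
        Ring.multichoose b (i + j) * ((1 - a)⁻¹) ^ (i + j) =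
    ((1 - a)⁻¹) ^ k * ∑ j ∈ Finset.range (k + 1),
      (-a) ^ j * ((n + j).choose j) * Ring.multichoose (b + (n + j : ℕ) + 1) (k - j) := by
  have h1 : ∀ j ∈ Finset.range (n + 1), ∑ i ∈ Finset.range (k + (n - j) + 1),
      (-1 : ℝ) ^ j * ((k + (n - j)).choose (n - j)) * ((i + j).choose j) *
        Ring.multichoose b (i + j) * ((1 - a)⁻¹) ^ (i + j) =
      ∑ s ∈ Finset.range (k + 1 + n),
        (Ring.multichoose b s * ((1 - a)⁻¹) ^ s) *
          ((-1 : ℝ) ^ j * s.choose j * ((k + (n - j)).choose (n - j))) := by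
    intro j hj
    have hj' := Finset.mem_range.mp hj
    rw [show k + 1 + n = j + (k + (n - j) + 1) by omega, Finset.sum_range_add _ j,
      Finset.sum_eq_zero (s := Finset.range j), zero_add]
    · refine Finset.sum_congr rfl fun i _ => ?_
      rw [add_comm j i]
      ring
    · intro s hs
      rw [Nat.choose_eq_zero_of_lt (Finset.mem_range.mp hs)]
      simp
  rw [Finset.sum_congr rfl h1, Finset.sum_comm, ← sum_choose_mul_multichoose]
  simp only [← Finset.mul_sum, sum_alternating_choose]
  rw [Finset.sum_range_add, Finset.sum_eq_zero (s := Finset.range n), add_zero, Finset.mul_sum]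
  · refine Finset.sum_congr rfl fun s hs => ?_
    have hs' : s ≤ k := Nat.lt_succ_iff.mp (Finset.mem_range.mp hs)
    rw [multichoose_sub_of_le k n s hs']
    obtain ⟨t, rfl⟩ := Nat.exists_eq_add_of_le hs'
    rw [Nat.add_sub_cancel_left, pow_add, inv_pow, inv_pow]
    field_simp
  · intro s hs
    rw [multichoose_sub_eq_zero k n _ (by omega)
      (by have := Finset.mem_range.mp hs; omega), mul_zero]

theorem eval_meixner (a c : ℝ) (n : ℕ) (x : ℝ) :
    (meixner a c n).eval x = (-1) ^ n * ∑ j ∈ Finset.range (n + 1),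
      a⁻¹ ^ j * Ring.choose x j * Ring.choose (-x - c) (n - j) := by
  simp [meixner, eval_finsetSum, eval_pbinom]

theorem eval_meixner_inv (a b : ℝ) (k n : ℕ) :
    (meixner a⁻¹ (2 - (b + k + 1)) k).eval (-(n : ℝ) - 1) =
      (-1) ^ k * ∑ j ∈ Finset.range (k + 1),
        (-a) ^ j * ((n + j).choose j) * Ring.multichoose (b + (n + j : ℕ) + 1) (k - j) := by
  rw [eval_meixner]
  congr 1
  refine Finset.sum_congr rfl fun j hj => ?_
  have hj' : j ≤ k := Nat.lt_succ_iff.mp (Finset.mem_range.mp hj)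
  rw [← neg_add', choose_neg_eq_multichoose, multichoose_natCast_succ, Ring.multichoose_eq,
    Nat.cast_sub hj', neg_pow a, inv_inv]
  have : -(-((n : ℝ) + 1)) - (2 - (b + k + 1)) = b + (n + j : ℕ) + 1 + (k - j) - 1 := by
    push_cast
    ring
  rw [this]
  ring

/-- Each summand is a finite combination of the terms of `hasSum_Gamma_choose`. -/
theorem summand_eq (a b : ℝ) (hb : ∀ m : ℕ, b ≠ -(m : ℝ)) (k n x : ℕ) :
    a ^ x * Real.Gamma (x + (b + k + 1)) / ((x + b) * x.factorial) *
        (meixner a (b + k + 1) n).eval (x : ℝ) =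
      ∑ j ∈ Finset.range (n + 1), ∑ i ∈ Finset.range (k + (n - j) + 1),
        ((-1) ^ j * a⁻¹ ^ j * ((k + (n - j)).factorial / ((n - j).factorial * i.factorial))) *
          (a ^ x * Real.Gamma (x + b + i) / x.factorial * (x.choose j : ℝ)) := by
  have hy : ∀ m : ℕ, (x : ℝ) + b ≠ -(m : ℝ) := fun m h =>
    hb (m + x) (by push_cast; linarith)
  have hc : ∀ m : ℕ, (x : ℝ) + (b + k + 1) ≠ -(m : ℝ) := fun m h =>
    hb (m + x + k + 1) (by push_cast; linarith)
  have hy0 : (x : ℝ) + b ≠ 0 := by simpa using hy 0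
  rw [eval_meixner, Finset.mul_sum, Finset.mul_sum]
  refine Finset.sum_congr rfl fun j hj => ?_
  obtain ⟨m, rfl⟩ : ∃ m, n = j + m :=
    Nat.exists_eq_add_of_le (Nat.lt_succ_iff.mp (Finset.mem_range.mp hj))
  rw [Nat.add_sub_cancel_left]
  have h1 := Gamma_add_nat _ hc m
  have h2 := Gamma_div_eq_sum _ hy (k + m)
  have h3 : (x : ℝ) + b + (k + m : ℕ) + 1 = x + (b + k + 1) + m := by push_cast; ring
  rw [h3, h1] at h2
  have h4 : ∑ i ∈ Finset.range (k + m + 1),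
        ((-1) ^ j * a⁻¹ ^ j * ((k + m).factorial / (m.factorial * i.factorial))) *
          (a ^ x * Real.Gamma (x + b + i) / x.factorial * (x.choose j : ℝ)) =
      ((-1) ^ j * a⁻¹ ^ j * a ^ x / (m.factorial * x.factorial) * (x.choose j : ℝ)) *
        ∑ i ∈ Finset.range (k + m + 1),
          ((k + m).factorial : ℝ) / i.factorial * Real.Gamma (x + b + i) := by
    rw [Finset.mul_sum]
    refine Finset.sum_congr rfl fun i _ => ?_
    field_simp
  have h5 : ((-1 : ℝ) ^ m) ^ 2 = 1 := by rw [← pow_mul, mul_comm, pow_mul]; simp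
  rw [h4, ← h2, ← neg_add', choose_neg_eq_multichoose, Ring.choose_natCast, pow_add]
  field_simp
  rw [h5]
  ring

theorem hasSum_meixner (a b : ℝ) (ha0 : a ≠ 0) (ha : |a| < 1) (hb : ∀ m : ℕ, b ≠ -(m : ℝ))
    (k n : ℕ) :
    HasSum (fun x : ℕ => a ^ x * Real.Gamma (x + (b + k + 1)) / ((x + b) * x.factorial) *
        (meixner a (b + k + 1) n).eval (x : ℝ))
      ((1 - a) ^ (-b) * (Real.Gamma b * k.factorial *
        (((1 - a)⁻¹) ^ k * ∑ j ∈ Finset.range (k + 1),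
          (-a) ^ j * ((n + j).choose j) *
            Ring.multichoose (b + (n + j : ℕ) + 1) (k - j)))) := by
  have h1 : 0 < 1 - a := by linarith [(abs_lt.mp ha).2]
  simp only [summand_eq a b hb]
  rw [← double_sum_eq a b h1.ne' k n, Finset.mul_sum, Finset.mul_sum]
  refine hasSum_sum fun j _ => ?_
  rw [Finset.mul_sum, Finset.mul_sum]
  refine hasSum_sum fun i _ => ?_
  convert! (hasSum_Gamma_choose a b ha hb i j).mul_left _ using 1
  rw [Gamma_add_nat b hb, neg_add, Real.rpow_add h1, Real.rpow_neg h1.le ((i + j : ℕ) : ℝ),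
    Real.rpow_natCast, inv_pow, ← Nat.choose_symm_add, ← Nat.choose_symm_add]
  simp only [Nat.cast_add_choose]
  rw [inv_pow a]
  field_simp

/-- Lemma 5.3: `⟨ρ̃_{k,a,c}, m_n^{a,c}⟩ = (-1)^k k! Γ(c-k-1) m_k^{1/a,2-c}(-n-1)/(1-a)^k`. -/
theorem stmt11 (k : ℕ) (hk : 1 ≤ k) (a : ℝ) (ha : 0 < |a|) (ha1 : |a| < 1)
    (c : ℝ) (hc : ∀ m : ℕ, c - k - 1 ≠ -(m : ℝ)) (n : ℕ) :
    Summable (fun x : ℕ =>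
      |a^x * Real.Gamma ((x : ℝ) + c) / (((x : ℝ) + c - k - 1) * x.factorial)
        * (meixner a c n).eval (x : ℝ)|) ∧
    (1-a) ^ (c - (k : ℝ) - 1) *
      ∑' x : ℕ, a^x * Real.Gamma ((x : ℝ) + c) / (((x : ℝ) + c - k - 1) * x.factorial)
        * (meixner a c n).eval (x : ℝ)
      = (-1:ℝ)^k * k.factorial * Real.Gamma (c - k - 1)
          * (meixner a⁻¹ (2-c) k).eval (-(n : ℝ) - 1) / (1-a)^k := by
  obtain ⟨b, rfl⟩ : ∃ b : ℝ, c = b + k + 1 := ⟨c - k - 1, by ring⟩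
  have e1 : b + k + 1 - k - 1 = b := by ring
  have e2 (x : ℕ) : (x : ℝ) + (b + k + 1) - k - 1 = x + b := by ring
  rw [e1] at hc ⊢
  simp only [e2]
  have h := hasSum_meixner a b (abs_pos.mp ha) ha1 hc k n
  have h1 : 0 < 1 - a := by linarith [(abs_lt.mp ha1).2]
  have h2 : ((-1 : ℝ) ^ k) ^ 2 = 1 := by rw [← pow_mul, mul_comm, pow_mul]; simp
  refine ⟨h.summable.abs, ?_⟩
  rw [h.tsum_eq, eval_meixner_inv, ← mul_assoc, ← Real.rpow_add h1, add_neg_cancel,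
    Real.rpow_zero, inv_pow]
  field_simp
  rw [h2]
  ring
end
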